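/- arXiv:2003.01203 — 4 statements merged into one kernel-verified Lean document; each statement's English description precedes it below -/
import Mathlib

section
/- Let n be a natural number, d ≥ 1 a real, and r, s natural numbers with ⌊d⌋ ≤ r ≤ s and s < n. Then the count satisfies 0 ≤ c(r,s) < (α(n,d) + 1)·r. -/
/-- Ackermann's function: `A 0 n = n + 1`, `A (k+1) 0 = A k 1`,
`A (k+1) (n+1) = A k (A (k+1) n)`. -/
def A : ℕ → ℕ → ℕ := ack

/-- `α(n, d) = min {k > 0 | A k ⌊d⌋ > n}`. -/
noncomputable def alpha (n : ℕ) (d : ℝ) : ℕ := sInf {k : ℕ | 0 < k ∧ n < A k ⌊d⌋₊}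

/-- The level `a(r, s) = min {k ≥ 0 | A k r > s}`. -/
noncomputable def lvl (r s : ℕ) : ℕ := sInf {k : ℕ | s < A k r}

/-- The index `b(r, s) = max {i ≥ 0 | A (a(r,s)) i ≤ s}`. -/
noncomputable def idx (r s : ℕ) : ℕ := sSup {i : ℕ | A (lvl r s) i ≤ s}

/-- The count `c(r, s) = r · a(r,s) + b(r,s)`. -/
noncomputable def cnt (r s : ℕ) : ℕ := r * lvl r s + idx r s

/-- The index is smaller than `r`, as `A` is monotone in its second argument. -/
theorem idx_lt {r s : ℕ} (hr : 0 < r) : idx r s < r := by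
  have hlvl : s < A (lvl r s) r :=
    Nat.sInf_mem (s := {k : ℕ | s < A k r}) ⟨s, lt_ack_left s r⟩
  have hidx : idx r s ≤ r - 1 := by
    refine csSup_le' fun i (hi : A (lvl r s) i ≤ s) => Nat.le_sub_one_of_lt ?_
    exact (ack_strictMono_right (lvl r s)).lt_iff_lt.mp (hi.trans_lt hlvl)
  omega

/-- The level is bounded by the inverse Ackermann function. -/
theorem lvl_le_alpha {n : ℕ} {d : ℝ} {r s : ℕ} (hdr : ⌊d⌋₊ ≤ r) (hs : s < n) :
    lvl r s ≤ alpha n d := by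
  have halpha : 0 < alpha n d ∧ n < A (alpha n d) ⌊d⌋₊ :=
    Nat.sInf_mem (s := {k : ℕ | 0 < k ∧ n < A k ⌊d⌋₊})
      ⟨n, Nat.zero_lt_of_lt hs, lt_ack_left n _⟩
  exact Nat.sInf_le (hs.trans (halpha.2.trans_le (ack_mono_right _ hdr)))

/-- For `d ≥ 1`, `⌊d⌋ ≤ r ≤ s` and `s < n`, the count satisfies
`0 ≤ c(r,s) < (α(n,d) + 1) · r`. -/
theorem count_bounds (n : ℕ) (d : ℝ) (r s : ℕ)
    (hd : 1 ≤ d) (hdr : ⌊d⌋₊ ≤ r) (hrs : r ≤ s) (hs : s < n) :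
    cnt r s < (alpha n d + 1) * r := by
  have hr : 0 < r := (Nat.floor_pos.mpr hd).trans_le hdr
  calc cnt r s < r * lvl r s + r := Nat.add_lt_add_left (idx_lt hr) _
    _ = (lvl r s + 1) * r := by ring
    _ ≤ (alpha n d + 1) * r := by gcongr; exact lvl_le_alpha hdr hs
end

section
/- Let r, s, s′ be natural numbers with 1 ≤ r ≤ s ≤ s′. Then the count never decreases, c(r,s) ≤ c(r,s′), and any increase in level forces at least as large an increase in count: c(r,s′) − c(r,s) ≥ a(r,s′) − a(r,s). -/
theorem lt_A_lvl (r s : ℕ) : s < A (lvl r s) r :=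
  Nat.sInf_mem (s := {k : ℕ | s < A k r})
    ⟨s, lt_ack_left s r⟩

theorem lvl_mono (r : ℕ) : Monotone (lvl r) := fun _ s' hss =>
  Nat.sInf_le (hss.trans_lt (lt_A_lvl r s'))

theorem lt_of_A_lvl_le {r s i : ℕ} (hi : A (lvl r s) i ≤ s) : i < r :=
  ack_lt_iff_right.1 (hi.trans_lt (lt_A_lvl r s))

theorem idx_le_sub_one (r s : ℕ) : idx r s ≤ r - 1 :=
  csSup_le' fun _ hi => Nat.le_sub_one_of_lt (lt_of_A_lvl_le hi)

theorem idx_le_idx_of_lvl_eq {r s s' : ℕ} (hss : s ≤ s') (h : lvl r s = lvl r s') :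
    idx r s ≤ idx r s' :=
  csSup_le_csSup' ⟨r, fun _ hi => (lt_of_A_lvl_le hi).le⟩ fun i (hi : A (lvl r s) i ≤ s) =>
    show A (lvl r s') i ≤ s' from h ▸ hi.trans hss

/-- For `1 ≤ r ≤ s ≤ s'`, the count never decreases, and any increase in level
forces at least as large an increase in count. -/
theorem count_monotone (r s s' : ℕ) (hr : 1 ≤ r) (hrs : r ≤ s) (hss : s ≤ s') :
    cnt r s ≤ cnt r s' ∧ lvl r s' - lvl r s ≤ cnt r s' - cnt r s := by
  have hb := idx_le_sub_one r s
  unfold cnt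
  rcases (lvl_mono r hss).eq_or_lt with h | h
  · have := idx_le_idx_of_lvl_eq hss h
    rw [h]
    omega
  · obtain ⟨d, hd⟩ := Nat.exists_eq_add_of_lt h
    obtain ⟨q, rfl⟩ := Nat.exists_eq_add_of_le' hr
    have hmul : (q + 1) * lvl (q + 1) s' = (q + 1) * lvl (q + 1) s + q * d + d + q + 1 := by
      rw [hd]
      ring
    have := Nat.zero_le (q * d)
    omega
end

section
/- Let u, v, w, x be natural numbers with 1 ≤ u ≤ v ≤ w ≤ x. If a(v,w) > a(u,v), then a(u,x) ≥ a(v,w) and consequently c(u,x) ≥ c(u,v) + (a(v,w) − a(u,v)). -/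
theorem lt_lvl_iff {k r s : ℕ} : k < lvl r s ↔ A k r ≤ s := by
  constructor
  · intro h
    exact not_lt.mp (Nat.notMem_of_lt_sInf (s := {k : ℕ | s < A k r}) h)
  · intro h
    exact ack_lt_iff_left.mp (h.trans_lt (lt_A_lvl r s))

theorem idx_add_one_le {r s : ℕ} (hr : 1 ≤ r) : idx r s + 1 ≤ r := by
  have h : idx r s ≤ r - 1 := csSup_le' fun i hi =>
    Nat.le_sub_one_of_lt (ack_lt_iff_right.mp (lt_of_le_of_lt hi (lt_A_lvl r s)))
  omega

/-- For `1 ≤ u ≤ v ≤ w ≤ x`, if `a(v,w) > a(u,v)` then `a(u,x) ≥ a(v,w)` and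
consequently `c(u,x) ≥ c(u,v) + (a(v,w) - a(u,v))`. -/
theorem level_increase_increases_count (u v w x : ℕ)
    (hu : 1 ≤ u) (huv : u ≤ v) (hvw : v ≤ w) (hwx : w ≤ x)
    (h : lvl u v < lvl v w) :
    lvl v w ≤ lvl u x ∧ cnt u v + (lvl v w - lvl u v) ≤ cnt u x := by
  have hle : lvl v w ≤ lvl u x := le_of_forall_lt fun k hk =>
    lt_lvl_iff.mpr (((ack_mono_right k huv).trans (lt_lvl_iff.mp hk)).trans hwx)
  refine ⟨hle, ?_⟩
  have hidx := idx_add_one_le (s := v) hu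
  obtain ⟨d, hd⟩ := Nat.exists_eq_add_of_lt h
  have hmul : u * lvl v w ≤ u * lvl u x := Nat.mul_le_mul_left u hle
  have hsub : lvl v w - lvl u v = d + 1 := by omega
  unfold cnt
  rw [hsub]
  rw [hd] at hmul
  nlinarith [Nat.mul_le_mul_right d hu]
end

section
/- Let t be a natural number and n = 2^t. Then the sum of the ranks satisfies ∑_{x=1}^{n} ρ(x) = n − 1; in particular the sum of ranks is at most n. -/
/-- For `n = 2 ^ t` and `x ∈ {1, …, n}`, the rank
`ρ(x) = t - ⌈log₂ (n - x + 1)⌉`. -/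
def rho (t x : ℕ) : ℕ := t - Nat.clog 2 (2 ^ t - x + 1)

theorem sum_range_sub_clog (t : ℕ) :
    ∑ y ∈ Finset.range (2 ^ t), (t - Nat.clog 2 (y + 1)) + 1 = 2 ^ t := by
  induction t with
  | zero => simp
  | succ t ih =>
    have lower : ∑ y ∈ Finset.range (2 ^ t), (t + 1 - Nat.clog 2 (y + 1)) =
        ∑ y ∈ Finset.range (2 ^ t), (t - Nat.clog 2 (y + 1)) + 2 ^ t := by
      calc _ = ∑ y ∈ Finset.range (2 ^ t), ((t - Nat.clog 2 (y + 1)) + 1) :=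
            Finset.sum_congr rfl fun y hy => by
              have hle : Nat.clog 2 (y + 1) ≤ t :=
                Nat.clog_le_of_le_pow (Finset.mem_range.mp hy)
              omega
        _ = _ := by simp [Finset.sum_add_distrib]
    have upper : ∑ y ∈ Finset.range (2 ^ t), (t + 1 - Nat.clog 2 (2 ^ t + y + 1)) = 0 :=
      Finset.sum_eq_zero fun y _ => by
        have hlt : t < Nat.clog 2 (2 ^ t + y + 1) :=
          (Nat.lt_clog_iff_pow_lt Nat.one_lt_two).mpr (by omega)
        omega
    rw [pow_succ, mul_two, Finset.sum_range_add, lower, upper]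
    omega

/-- Let `n = 2 ^ t`.  The sum of the ranks is `n - 1`; in particular it is at
most `n`. -/
theorem rank_sum (t : ℕ) :
    (∑ x ∈ Finset.Icc 1 (2 ^ t), rho t x) = 2 ^ t - 1 ∧
      (∑ x ∈ Finset.Icc 1 (2 ^ t), rho t x) ≤ 2 ^ t := by
  have reindex : ∑ x ∈ Finset.Icc 1 (2 ^ t), rho t x =
      ∑ y ∈ Finset.range (2 ^ t), (t - Nat.clog 2 (y + 1)) := by
    refine Finset.sum_nbij' (fun x => 2 ^ t - x) (fun y => 2 ^ t - y) ?_ ?_ ?_ ?_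
      fun _ _ => rfl
    all_goals
      intro z hz
      simp only [Finset.mem_Icc, Finset.mem_range] at hz ⊢
      omega
  have total := sum_range_sub_clog t
  omega
end
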